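/- arXiv:1507.08495 — 2 statements merged into one kernel-verified Lean document; each statement's English description precedes it below -/
import Mathlib

section
/- Let w, b : ℕ → ℕ be the numbers of white and black nodes at each level of the Fibonacci tree, i.e. w 0 = 1, b 0 = 0, and for every n, w (n+1) = 2 * w n + b n and b (n+1) = w n + b n. Then for every n, the total number of nodes at level n equals the Fibonacci number f_{2n+1}, where the Fibonacci sequence is indexed with f_0 = f_1 = 1; in Mathlib's indexing (Nat.fib 0 = 0, Nat.fib 1 = Nat.fib 2 = 1) this reads w n + b n = Nat.fib (2*n + 2). -/
/-- The total number of nodes at level `n` of the Fibonacci tree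
(`w n` white nodes and `b n` black nodes) equals the Fibonacci number
`f_{2n+1}` in the paper's indexing (`f_0 = f_1 = 1`), i.e.
`Nat.fib (2*n + 2)` in Mathlib's indexing. -/
theorem fibonacci_tree_level_count (w b : ℕ → ℕ)
    (hw0 : w 0 = 1) (hb0 : b 0 = 0)
    (hw : ∀ n, w (n + 1) = 2 * w n + b n)
    (hb : ∀ n, b (n + 1) = w n + b n) :
    ∀ n, w n + b n = Nat.fib (2 * n + 2) := by
  have key : ∀ n, w n = Nat.fib (2 * n + 1) ∧ b n = Nat.fib (2 * n) := by
    intro n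
    induction n with
    | zero => simp [hw0, hb0]
    | succ k ih =>
      obtain ⟨h1, h2⟩ := ih
      have e1 : Nat.fib (2 * k + 2) = Nat.fib (2 * k) + Nat.fib (2 * k + 1) := Nat.fib_add_two
      have e2 : Nat.fib (2 * k + 3) = Nat.fib (2 * k + 1) + Nat.fib (2 * k + 2) := Nat.fib_add_two
      rw [hw, hb, h1, h2, show 2 * (k + 1) + 1 = 2 * k + 3 by ring,
        show 2 * (k + 1) = 2 * k + 2 by ring]
      omega
  intro n
  rw [(key n).1, (key n).2, Nat.fib_add_two, add_comm]
end

section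
/- Let w, b : ℕ → ℕ with w 0 = 1, b 0 = 0, and for every n, w (n+1) = 2 * w n + b n and b (n+1) = w n + b n. Then for every n, the number of white nodes at level n is w n = Nat.fib (2*n + 1) and the number of black nodes at level n is b n = Nat.fib (2*n) (Mathlib's indexing, Nat.fib 0 = 0, Nat.fib 1 = Nat.fib 2 = 1); equivalently, in the paper's indexing with f_0 = f_1 = 1, the level n of the Fibonacci tree contains f_{2n} white nodes and, for n ≥ 1, f_{2n-1} black nodes. -/
/-- Level `n` of the Fibonacci tree contains `Nat.fib (2*n + 1)` white nodes
and `Nat.fib (2*n)` black nodes (Mathlib's indexing); equivalently,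
`f_{2n}` white nodes and, for `n ≥ 1`, `f_{2n-1}` black nodes in the paper's
indexing with `f_0 = f_1 = 1`. -/
theorem fibonacci_tree_white_black_count (w b : ℕ → ℕ)
    (hw0 : w 0 = 1) (hb0 : b 0 = 0)
    (hw : ∀ n, w (n + 1) = 2 * w n + b n)
    (hb : ∀ n, b (n + 1) = w n + b n) :
    ∀ n, w n = Nat.fib (2 * n + 1) ∧ b n = Nat.fib (2 * n) := by
  intro n
  induction n with
  | zero => simp [hw0, hb0]
  | succ k ih =>
    obtain ⟨h1, h2⟩ := ih
    have e1 : Nat.fib (2 * k + 2) = Nat.fib (2 * k) + Nat.fib (2 * k + 1) := Nat.fib_add_two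
    have e2 : Nat.fib (2 * k + 3) = Nat.fib (2 * k + 1) + Nat.fib (2 * k + 2) := Nat.fib_add_two
    have a1 : 2 * (k + 1) + 1 = 2 * k + 3 := by ring
    have a2 : 2 * (k + 1) = 2 * k + 2 := by ring
    rw [hw, hb, a1, a2, h1, h2]
    omega
end
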